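/- Let γ₁, γ₂, γ₃, Δ, Ω, Ω', Ω₁, Ω₂, Ω₃ be real numbers with Ω > 0, Ω'² = Ω², and Ω₁² + Ω₂² + Ω₃² = Ω². Set g := γ₁ + γ₂ + γ₃ and w := (γ₁Ω₁² + γ₂Ω₂² + γ₃Ω₃²)/Ω². Then the 4×4 complex matrix M := [[−g, −iΩ', iΩ', 0], [−iΩ', −g/2 + iΔ, 0, iΩ'], [iΩ', 0, −g/2 − iΔ, −iΩ'], [w, iΩ', −iΩ', 0]] satisfies det M = (γ₁ + γ₂ + γ₃) · Σ_{i=1}^{3} γ_i (Ω² − Ω_i²); in particular det M is independent of Δ. -/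

import Mathlib

theorem det_reduced_generator {R : Type*} [CommRing R] (a b d e w : R) :
    Matrix.det !![a, -b, b, 0; -b, d, 0, b; b, 0, e, -b; w, b, -b, 0] =
      -((a + w) * b ^ 2 * (d + e)) := by
  simp [Matrix.det_succ_row_zero, Fin.sum_univ_succ, Fin.succAbove]
  ring

/-- determinant of the reduced generator matrix of the four-level
quantum-optical system: `det M = (γ₁+γ₂+γ₃)·Σᵢ γᵢ(Ω² − Ωᵢ²)`, independent of `Δ`. -/
theorem statement15 (γ₁ γ₂ γ₃ Δ Ω Ω' Ω₁ Ω₂ Ω₃ : ℝ) (hΩ : 0 < Ω)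
    (hΩ' : Ω' ^ 2 = Ω ^ 2) (hsum : Ω₁ ^ 2 + Ω₂ ^ 2 + Ω₃ ^ 2 = Ω ^ 2) :
    Matrix.det
      !![(-((γ₁ : ℂ) + γ₂ + γ₃)), -Complex.I * (Ω' : ℂ), Complex.I * (Ω' : ℂ), 0;
         -Complex.I * (Ω' : ℂ), -((γ₁ : ℂ) + γ₂ + γ₃)/2 + Complex.I * (Δ : ℂ), 0,
           Complex.I * (Ω' : ℂ);
         Complex.I * (Ω' : ℂ), 0, -((γ₁ : ℂ) + γ₂ + γ₃)/2 - Complex.I * (Δ : ℂ),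
           -Complex.I * (Ω' : ℂ);
         (((γ₁ * Ω₁ ^ 2 + γ₂ * Ω₂ ^ 2 + γ₃ * Ω₃ ^ 2) / Ω ^ 2 : ℝ) : ℂ),
           Complex.I * (Ω' : ℂ), -Complex.I * (Ω' : ℂ), 0] =
      (((γ₁ + γ₂ + γ₃) * (γ₁ * (Ω ^ 2 - Ω₁ ^ 2) + γ₂ * (Ω ^ 2 - Ω₂ ^ 2)
        + γ₃ * (Ω ^ 2 - Ω₃ ^ 2)) : ℝ) : ℂ) := by
  have hΩ₀ : (Ω : ℂ) ≠ 0 := by exact_mod_cast hΩ.ne'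
  have hsq : (Ω' : ℂ) ^ 2 = (Ω : ℂ) ^ 2 := by exact_mod_cast hΩ'
  simp only [neg_mul]
  rw [det_reduced_generator, mul_pow, Complex.I_sq, hsq]
  push_cast
  field_simp
  ring
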